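/- Let λ be a partition of n with N parts, all of which are ≥ 2, with α_i parts equal to i for 2 ≤ i ≤ N' = λ₁. For k ≥ 0 let λ1^k be the partition of n+k obtained from λ by appending k parts equal to 1, and set G(x) = (1−x)^{n−N} · ∏_{i=2}^{N'} ∏_{j=1}^{α_i} (1−x^j) ∈ ℤ[x]. Then for every m ≥ 0 there exists K such that for all k ≥ K the coefficient of x^m in R_{λ1^k}(x) · G(x) equals 1 if m = 0 and equals 0 if m ≥ 1; that is, the power series limit of R_{λ1^k} as k → ∞ is 1/((1−x)^{n−N} S_{α₂} ⋯ S_{α_{N'}}) where S_k = (1−x)(1−x²)⋯(1−x^k). -/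

import Mathlib

open Polynomial

/-- `f` represents the partition `λ₁ ≥ λ₂ ≥ … ≥ λ_N > 0` of `n`:
`f i = λᵢ` for `1 ≤ i ≤ N` and `f i = 0` for `i > N`. -/
def IsPartitionFun (f : ℕ → ℕ) (n N : ℕ) : Prop :=
  (∀ i j, i ≤ j → f j ≤ f i) ∧ (∀ i, 1 ≤ i → (0 < f i ↔ i ≤ N)) ∧
    ∑ i ∈ Finset.Icc 1 N, f i = n

/-- `A` is strictly upper triangular: `A i j = 0` whenever `j ≤ i`. -/
def StrictUpper {m : ℕ} {F : Type*} [Zero F] (A : Matrix (Fin m) (Fin m) F) : Prop :=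
  ∀ i j : Fin m, (j : ℕ) ≤ (i : ℕ) → A i j = 0

/-- `A` has Jordan type `λ`: `rank (A ^ k) = Σᵢ max (λᵢ - k) 0` for every `k ≥ 0`. -/
def HasJordanType {m : ℕ} {F : Type*} [Field F] (A : Matrix (Fin m) (Fin m) F)
    (f : ℕ → ℕ) (N : ℕ) : Prop :=
  ∀ k : ℕ, (A ^ k).rank = ∑ i ∈ Finset.Icc 1 N, (f i - k)

/-- The number of strictly upper triangular `m × m` matrices over `F` of Jordan type `λ`. -/
noncomputable def jordanCount (m : ℕ) (f : ℕ → ℕ) (N : ℕ)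
    (F : Type) [Field F] [Fintype F] : ℕ :=
  Nat.card {A : Matrix (Fin m) (Fin m) F // StrictUpper A ∧ HasJordanType A f N}

/-- `dualPart f N j = λ'_j`, the number of parts of `λ` that are `≥ j`. -/
def dualPart (f : ℕ → ℕ) (N j : ℕ) : ℕ :=
  ((Finset.Icc 1 N).filter fun i => j ≤ f i).card

/-- `alphaCount f N k = α_k`, the number of parts of `λ` equal to `k`. -/
def alphaCount (f : ℕ → ℕ) (N k : ℕ) : ℕ :=
  ((Finset.Icc 1 N).filter fun i => f i = k).card

/-- The rows containing a removable cell of the Young diagram of `λ`: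
rows `1 ≤ i ≤ N` with `i = N` or `λ_{i+1} < λᵢ` (for `i = N` the condition
`f (i+1) < f i` holds automatically since `f (N+1) = 0 < f N`). -/
def removables (f : ℕ → ℕ) (N : ℕ) : Finset ℕ :=
  (Finset.Icc 1 N).filter fun i => f (i + 1) < f i

/-- The partition `λ1^k` obtained from `λ` (with `N` parts) by appending `k` parts
equal to `1`. -/
def extendOnes (f : ℕ → ℕ) (N k : ℕ) : ℕ → ℕ :=
  fun i => if i ≤ N then f i else if i ≤ N + k then 1 else 0

open scoped Matrix

/-- Border a square matrix by a last column `v` and a last row `0`. -/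
def borderCol {m : ℕ} {F : Type*} [Zero F] (B : Matrix (Fin m) (Fin m) F) (v : Fin m → F) :
    Matrix (Fin (m + 1)) (Fin (m + 1)) F :=
  Matrix.of (Fin.snoc (fun i => Fin.snoc (B i) (v i)) 0)

section border
variable {m : ℕ} {F : Type*} [Field F]

@[simp] lemma borderCol_castSucc_castSucc (B : Matrix (Fin m) (Fin m) F) (v : Fin m → F)
    (i j : Fin m) : borderCol B v i.castSucc j.castSucc = B i j := by
  simp [borderCol]

@[simp] lemma borderCol_castSucc_last (B : Matrix (Fin m) (Fin m) F) (v : Fin m → F)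
    (i : Fin m) : borderCol B v i.castSucc (Fin.last m) = v i := by
  simp [borderCol]

@[simp] lemma borderCol_last (B : Matrix (Fin m) (Fin m) F) (v : Fin m → F)
    (j : Fin (m + 1)) : borderCol B v (Fin.last m) j = 0 := by
  simp [borderCol]

lemma borderCol_mul (B C : Matrix (Fin m) (Fin m) F) (v w : Fin m → F) :
    borderCol B v * borderCol C w = borderCol (B * C) (B *ᵥ w) := by
  ext i j
  rw [Matrix.mul_apply, Fin.sum_univ_castSucc]
  refine Fin.lastCases ?_ (fun i => ?_) i
  · simp
  · refine Fin.lastCases ?_ (fun j => ?_) j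
    · simp [Matrix.mulVec, dotProduct]
    · simp [Matrix.mul_apply]

lemma borderCol_pow_succ (B : Matrix (Fin m) (Fin m) F) (v : Fin m → F) (k : ℕ) :
    borderCol B v ^ (k + 1) = borderCol (B ^ (k + 1)) ((B ^ k) *ᵥ v) := by
  induction k with
  | zero => simp
  | succ k ih =>
    rw [pow_succ', ih, borderCol_mul, ← pow_succ', Matrix.mulVec_mulVec, ← pow_succ']

lemma rank_borderCol (B : Matrix (Fin m) (Fin m) F) (v : Fin m → F) :
    (borderCol B v).rank =
      Module.finrank F ↥(LinearMap.range B.mulVecLin ⊔ Submodule.span F {v}) := by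
  let ι : (Fin m → F) →ₗ[F] (Fin (m + 1) → F) :=
    { toFun := fun x => Fin.snoc x 0
      map_add' := fun x y => by
        ext i; refine Fin.lastCases ?_ (fun i => ?_) i <;> simp
      map_smul' := fun a x => by
        ext i; refine Fin.lastCases ?_ (fun i => ?_) i <;> simp }
  have hι : Function.Injective ι := fun x y h => by
    ext i
    simpa [ι] using congrFun h i.castSucc
  rw [(Submodule.equivMapOfInjective ι hι _).finrank_eq, Matrix.rank]
  have key : ∀ x : Fin m → F, ∀ t : F,
      (borderCol B v) *ᵥ (Fin.snoc x t : Fin (m + 1) → F) = ι (B *ᵥ x + t • v) := by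
    intro x t
    ext i
    refine Fin.lastCases ?_ (fun i => ?_) i
    · simp [ι, Matrix.mulVec, dotProduct]
    · simp [ι, Matrix.mulVec, dotProduct, Fin.sum_univ_castSucc, mul_comm]
  suffices h : LinearMap.range (borderCol B v).mulVecLin =
      (LinearMap.range B.mulVecLin ⊔ Submodule.span F {v}).map ι by rw [h]
  ext y
  simp only [LinearMap.mem_range, Matrix.mulVecLin_apply, Submodule.mem_map, Submodule.mem_sup,
    Submodule.mem_span_singleton]
  constructor
  · rintro ⟨x, rfl⟩
    rw [← Fin.snoc_init_self x, key]
    exact ⟨_, ⟨_, ⟨_, rfl⟩, _, ⟨_, rfl⟩, rfl⟩, rfl⟩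
  · rintro ⟨_, ⟨_, ⟨x, rfl⟩, _, ⟨t, rfl⟩, rfl⟩, rfl⟩
    exact ⟨_, key x t⟩

/-- The vectors `v` such that `B ^ k v` lies in the image of `B ^ (k + 1)`. -/
def liftSpace (B : Matrix (Fin m) (Fin m) F) (k : ℕ) : Submodule F (Fin m → F) :=
  (LinearMap.range (B ^ (k + 1)).mulVecLin).comap (B ^ k).mulVecLin

lemma mem_liftSpace {B : Matrix (Fin m) (Fin m) F} {k : ℕ} {v : Fin m → F} :
    v ∈ liftSpace B k ↔ ∃ x, (B ^ (k + 1)) *ᵥ x = (B ^ k) *ᵥ v := by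
  simp [liftSpace]

lemma liftSpace_mono (B : Matrix (Fin m) (Fin m) F) : Monotone (liftSpace B) := by
  refine monotone_nat_of_le_succ fun k v hv => ?_
  obtain ⟨x, hx⟩ := mem_liftSpace.1 hv
  refine mem_liftSpace.2 ⟨x, ?_⟩
  rw [pow_succ', ← Matrix.mulVec_mulVec, hx, Matrix.mulVec_mulVec, ← pow_succ']

lemma finrank_liftSpace (B : Matrix (Fin m) (Fin m) F) (k : ℕ) :
    Module.finrank F (liftSpace B k) + (B ^ k).rank = m + (B ^ (k + 1)).rank := by
  have h1 := LinearMap.finrank_range_add_finrank_ker (B ^ k).mulVecLin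
  have h2 := LinearMap.finrank_range_add_finrank_ker
    ((B ^ k).mulVecLin.domRestrict (liftSpace B k))
  have h3 : LinearMap.range ((B ^ k).mulVecLin.domRestrict (liftSpace B k)) =
      LinearMap.range (B ^ (k + 1)).mulVecLin := by
    rw [LinearMap.range_domRestrict, liftSpace, Submodule.map_comap_eq, inf_eq_right]
    rintro _ ⟨x, rfl⟩
    exact ⟨B *ᵥ x, by simp [pow_succ]⟩
  have h4 : Module.finrank F
      (LinearMap.ker ((B ^ k).mulVecLin.domRestrict (liftSpace B k))) =
      Module.finrank F (LinearMap.ker (B ^ k).mulVecLin) := by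
    rw [LinearMap.ker_domRestrict]
    refine (Submodule.comapSubtypeEquivOfLe ?_).finrank_eq
    intro v hv
    refine mem_liftSpace.2 ⟨0, ?_⟩
    simpa using hv.symm
  rw [h3, h4] at h2
  simp only [Module.finrank_fin_fun] at h1
  simp only [Matrix.rank]
  omega

lemma rank_borderCol_pow {B : Matrix (Fin m) (Fin m) F} {v : Fin m → F} {c : ℕ}
    (hc : v ∈ liftSpace B c) (hlt : ∀ c' < c, v ∉ liftSpace B c') (k : ℕ) :
    (borderCol B v ^ k).rank = (B ^ k).rank + if k ≤ c then 1 else 0 := by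
  cases k with
  | zero => simp
  | succ k =>
    rw [borderCol_pow_succ, rank_borderCol]
    split_ifs with hk
    · exact Submodule.finrank_sup_span_singleton (hlt k hk)
    · have h : (B ^ k) *ᵥ v ∈ LinearMap.range (B ^ (k + 1)).mulVecLin :=
        liftSpace_mono B (by omega) hc
      rw [sup_eq_left.2 (by simpa using h)]
      rfl

end border

lemma strictUpper_borderCol {m : ℕ} {F : Type*} [Field F] {B : Matrix (Fin m) (Fin m) F}
    {v : Fin m → F} : StrictUpper (borderCol B v) ↔ StrictUpper B := by
  constructor
  · intro h i j hij
    simpa using h i.castSucc j.castSucc (by simpa using hij)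
  · intro h i j
    refine Fin.lastCases ?_ (fun i => ?_) i
    · simp
    · refine Fin.lastCases ?_ (fun j => ?_) j
      · intro hij
        have := i.isLt
        simp at hij
        omega
      · simpa using h i j

lemma StrictUpper.exists_borderCol {m : ℕ} {F : Type*} [Field F]
    {A : Matrix (Fin (m + 1)) (Fin (m + 1)) F} (hA : StrictUpper A) :
    ∃ B v, borderCol B v = A := by
  refine ⟨Matrix.of fun i j => A i.castSucc j.castSucc, fun i => A i.castSucc (Fin.last m), ?_⟩
  ext i j
  refine Fin.lastCases ?_ (fun i => ?_) i
  · rw [borderCol_last, hA]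
    exact Nat.lt_succ_iff.1 j.isLt
  · refine Fin.lastCases ?_ (fun j => ?_) j <;> simp

lemma borderCol_injective {m : ℕ} {F : Type*} [Field F] :
    Function.Injective (fun p : Matrix (Fin m) (Fin m) F × (Fin m → F) => borderCol p.1 p.2) := by
  rintro ⟨B, v⟩ ⟨C, w⟩ h
  simp only at h
  ext i j
  · simpa using congrFun (congrFun h i.castSucc) j.castSucc
  · simpa using congrFun (congrFun h i.castSucc) (Fin.last m)

/-- Remove one from the `c`-th entry of `g`: this deletes the last cell of column `c`. -/
def removeCell (g : ℕ → ℕ) (c : ℕ) : ℕ → ℕ := Function.update g c (g c - 1)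

lemma removeCell_same (g : ℕ → ℕ) (c : ℕ) : removeCell g c c = g c - 1 := by
  simp [removeCell]

lemma removeCell_of_ne (g : ℕ → ℕ) {c j : ℕ} (h : j ≠ c) : removeCell g c j = g j := by
  simp [removeCell, h]

lemma sum_Ico_removeCell {g : ℕ → ℕ} {c L : ℕ} (hc : c < L) (hg : 0 < g c) (k : ℕ) :
    ∑ j ∈ Finset.Ico k L, removeCell g c j + (if k ≤ c then 1 else 0) =
      ∑ j ∈ Finset.Ico k L, g j := by
  have h : ∀ j, g j = removeCell g c j + if c = j then 1 else 0 := by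
    intro j
    by_cases hj : c = j
    · subst hj; simp [removeCell_same]; omega
    · simp [removeCell_of_ne g (Ne.symm hj), hj]
  simp_rw [Finset.sum_congr rfl fun j _ => h j, Finset.sum_add_distrib, Finset.sum_ite_eq]
  simp [hc]

/-- The ranks of the powers of `A` are the tail sums of `g`, i.e. `g` lists the column lengths
of the Jordan type of `A`. -/
def HasColumns {m : ℕ} {F : Type*} [Field F] (L : ℕ) (A : Matrix (Fin m) (Fin m) F)
    (g : ℕ → ℕ) : Prop :=
  ∀ k : ℕ, (A ^ k).rank = ∑ j ∈ Finset.Ico k L, g j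

section columns
variable {m L : ℕ} {F : Type*} [Field F]

lemma hasColumns_borderCol_of_mem {B : Matrix (Fin m) (Fin m) F} {v : Fin m → F} {c : ℕ}
    (hc : v ∈ liftSpace B c) (hlt : ∀ c' < c, v ∉ liftSpace B c') {g : ℕ → ℕ} :
    HasColumns L (borderCol B v) g ↔ c < L ∧ 0 < g c ∧ HasColumns L B (removeCell g c) := by
  constructor
  · intro h
    have hcL : c < L := by
      by_contra! hL
      have := h L
      rw [rank_borderCol_pow hc hlt] at this
      simp [hL] at this
    have hg : 0 < g c := by
      have h1 := h c
      have h2 := h (c + 1)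
      rw [rank_borderCol_pow hc hlt] at h1 h2
      rw [Finset.sum_eq_sum_Ico_succ_bot hcL, ← h2] at h1
      have h3 : (B ^ (c + 1)).rank ≤ (B ^ c).rank := pow_succ B c ▸ Matrix.rank_mul_le_left _ _
      simp at h1
      omega
    refine ⟨hcL, hg, fun k => ?_⟩
    have h1 := h k
    rw [rank_borderCol_pow hc hlt, ← sum_Ico_removeCell hcL hg] at h1
    omega
  · rintro ⟨hcL, hg, h⟩ k
    rw [rank_borderCol_pow hc hlt, ← sum_Ico_removeCell hcL hg, h k]

lemma HasColumns.exists_mem_liftSpace {B : Matrix (Fin m) (Fin m) F} {v : Fin m → F}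
    {g : ℕ → ℕ} (h : HasColumns L (borderCol B v) g) : ∃ c, v ∈ liftSpace B c := by
  refine ⟨L, ?_⟩
  have h1 := h (L + 1)
  rw [borderCol_pow_succ, rank_borderCol] at h1
  simp only [Finset.Ico_eq_empty_of_le (Nat.le_succ L), Finset.sum_empty,
    Submodule.finrank_eq_zero] at h1
  have h2 : (B ^ L) *ᵥ v = 0 := by
    have : (B ^ L) *ᵥ v ∈ (⊥ : Submodule F (Fin m → F)) :=
      h1 ▸ Submodule.mem_sup_right (Submodule.mem_span_singleton_self _)
    simpa using this
  exact mem_liftSpace.2 ⟨0, by simp [h2]⟩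

lemma HasColumns.card_liftSpace [Fintype F] {B : Matrix (Fin m) (Fin m) F} {h : ℕ → ℕ}
    (hB : HasColumns L B h) {c : ℕ} (hc : c < L) :
    Nat.card (liftSpace B c) * Fintype.card F ^ h c = Fintype.card F ^ m := by
  have h1 := finrank_liftSpace B c
  rw [hB c, hB (c + 1), Finset.sum_eq_sum_Ico_succ_bot hc] at h1
  rw [Module.natCard_eq_pow_finrank (K := F), Nat.card_eq_fintype_card, ← pow_add]
  congr 1
  omega

lemma HasColumns.le_of_lt [Fintype F] {B : Matrix (Fin m) (Fin m) F} {h : ℕ → ℕ}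
    (hB : HasColumns L B h) {c : ℕ} (hc : c + 1 < L) : h (c + 1) ≤ h c := by
  have h1 := finrank_liftSpace B c
  have h2 := finrank_liftSpace B (c + 1)
  rw [hB c, hB (c + 1), Finset.sum_eq_sum_Ico_succ_bot (by omega)] at h1
  rw [hB (c + 1), hB (c + 1 + 1), Finset.sum_eq_sum_Ico_succ_bot hc] at h2
  have := Submodule.finrank_mono (liftSpace_mono B (Nat.le_succ c))
  simp only [Nat.succ_eq_add_one] at this
  omega

open Classical in
/-- The vectors whose bordering adds a cell in column `c`. -/
noncomputable def cellVectors [Fintype F] (B : Matrix (Fin m) (Fin m) F) (c : ℕ) :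
    Finset (Fin m → F) :=
  {v | v ∈ liftSpace B c ∧ ∀ c' < c, v ∉ liftSpace B c'}

lemma mem_cellVectors [Fintype F] {B : Matrix (Fin m) (Fin m) F} {c : ℕ} {v : Fin m → F} :
    v ∈ cellVectors B c ↔ v ∈ liftSpace B c ∧ ∀ c' < c, v ∉ liftSpace B c' := by
  simp [cellVectors]

lemma card_cellVectors_zero [Fintype F] (B : Matrix (Fin m) (Fin m) F) :
    (cellVectors B 0).card = Nat.card (liftSpace B 0) := by
  classical
  rw [← SetLike.coe_sort_coe, Nat.card_eq_card_toFinset]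
  congr 1
  ext v
  simp [mem_cellVectors]

lemma card_cellVectors_succ [Fintype F] (B : Matrix (Fin m) (Fin m) F) (c : ℕ) :
    (cellVectors B (c + 1)).card + Nat.card (liftSpace B c) = Nat.card (liftSpace B (c + 1)) := by
  classical
  rw [← SetLike.coe_sort_coe, ← SetLike.coe_sort_coe, Nat.card_eq_card_toFinset,
    Nat.card_eq_card_toFinset, ← Finset.card_sdiff_add_card_eq_card
      (Set.toFinset_subset_toFinset.2 (liftSpace_mono B (Nat.le_succ c)))]
  congr 2
  ext v
  simp only [mem_cellVectors, Finset.mem_sdiff, Set.mem_toFinset, SetLike.mem_coe]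
  refine and_congr_right fun _ => ⟨fun h => h c (Nat.lt_succ_self c), fun h c' hc' h' => ?_⟩
  exact h (liftSpace_mono B (Nat.lt_succ_iff.1 hc') h')

open Classical in
/-- The strictly upper triangular matrices with column lengths `g`. -/
noncomputable def columnMatrices (L m : ℕ) (F : Type*) [Field F] [Fintype F] (g : ℕ → ℕ) :
    Finset (Matrix (Fin m) (Fin m) F) :=
  {A | StrictUpper A ∧ HasColumns L A g}

lemma mem_columnMatrices [Fintype F] {g : ℕ → ℕ} {A : Matrix (Fin m) (Fin m) F} :
    A ∈ columnMatrices L m F g ↔ StrictUpper A ∧ HasColumns L A g := by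
  simp [columnMatrices]

lemma card_columnMatrices_succ [Fintype F] (g : ℕ → ℕ) :
    (columnMatrices L (m + 1) F g).card = ∑ c ∈ Finset.range L,
      if 0 < g c then
        ∑ B ∈ columnMatrices L m F (removeCell g c), (cellVectors B c).card else 0 := by
  classical
  set S : ℕ → Finset (Σ _ : Matrix (Fin m) (Fin m) F, Fin m → F) := fun c =>
    if 0 < g c then (columnMatrices L m F (removeCell g c)).sigma fun B => cellVectors B c
    else ∅ with hS
  have hcard : ∀ c, (S c).card = if 0 < g c then
      ∑ B ∈ columnMatrices L m F (removeCell g c), (cellVectors B c).card else 0 := by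
    intro c
    simp only [hS]
    split_ifs
    · rw [Finset.card_sigma]
    · rfl
  have hmem : ∀ c B v, (⟨B, v⟩ : Σ _ : Matrix (Fin m) (Fin m) F, Fin m → F) ∈ S c ↔
      0 < g c ∧ (StrictUpper B ∧ HasColumns L B (removeCell g c)) ∧
        v ∈ liftSpace B c ∧ ∀ c' < c, v ∉ liftSpace B c' := by
    intro c B v
    simp only [hS]
    split_ifs with h
    · simp [h, mem_columnMatrices, mem_cellVectors]
    · simp [h]
  simp_rw [← hcard]
  rw [← Finset.card_biUnion]
  · symm
    refine Finset.card_bij (fun p _ => borderCol p.1 p.2) ?_ ?_ ?_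
    · rintro ⟨B, v⟩ hp
      obtain ⟨c, hc, hp⟩ := Finset.mem_biUnion.1 hp
      obtain ⟨h1, h2, h3, h4⟩ := (hmem c B v).1 hp
      exact mem_columnMatrices.2 ⟨strictUpper_borderCol.2 h2.1,
        (hasColumns_borderCol_of_mem h3 h4).2 ⟨Finset.mem_range.1 hc, h1, h2.2⟩⟩
    · rintro ⟨B, v⟩ _ ⟨C, w⟩ _ h
      have := borderCol_injective (a₁ := (B, v)) (a₂ := (C, w)) h
      simp only [Prod.mk.injEq] at this
      rw [this.1, this.2]
    · intro A hA
      obtain ⟨h1, h2⟩ := mem_columnMatrices.1 hA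
      obtain ⟨B, v, rfl⟩ := h1.exists_borderCol
      have hex := h2.exists_mem_liftSpace
      have hc := Nat.find_spec hex
      have hlt : ∀ c' < Nat.find hex, v ∉ liftSpace B c' := fun c' => Nat.find_min hex
      obtain ⟨h3, h4, h5⟩ := (hasColumns_borderCol_of_mem hc hlt).1 h2
      exact ⟨⟨B, v⟩, Finset.mem_biUnion.2 ⟨_, Finset.mem_range.2 h3, (hmem _ _ _).2
        ⟨h4, ⟨strictUpper_borderCol.1 h1, h5⟩, hc, hlt⟩⟩, rfl⟩
  · intro c _ c' _ hne
    rw [Function.onFun, Finset.disjoint_left]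
    rintro ⟨B, v⟩ h h'
    obtain ⟨-, -, h3, h4⟩ := (hmem _ _ _).1 h
    obtain ⟨-, -, h3', h4'⟩ := (hmem _ _ _).1 h'
    rcases lt_or_gt_of_ne hne with hl | hl
    · exact h4' _ hl h3
    · exact h4 _ hl h3'

end columns

/-- The contribution of deleting a cell from column `c` to the recursion for `colPoly`. -/
noncomputable def cellWeight (g : ℕ → ℕ) : ℕ → ℤ[X]
  | 0 => 1
  | c + 1 => ∑ i ∈ Finset.range (g c - g (c + 1) + 1), X ^ i

/-- The polynomial `R` attached to the partition of `m` with column lengths `g`. -/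
noncomputable def colPoly (L : ℕ) : ℕ → (ℕ → ℕ) → ℤ[X]
  | 0, _ => 1
  | m + 1, g => ∑ c ∈ Finset.range L,
      if g (c + 1) < g c then X ^ g (c + 1) * cellWeight g c * colPoly L m (removeCell g c) else 0

/-- `g` lists the column lengths of a partition of `m` with at most `L` columns. -/
structure IsColumns (L m : ℕ) (g : ℕ → ℕ) : Prop where
  anti : Antitone g
  zero : ∀ j, L ≤ j → g j = 0
  sum : ∑ j ∈ Finset.range L, g j = m

/-- The exponent of `q` by which the number of matrices with column lengths `g` is multiplied to
give `q ^ (m.choose 2) * (q - 1) ^ (m - g 0)` times the value of `colPoly` at `q`. -/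
def colEnergy (L : ℕ) (g : ℕ → ℕ) : ℕ :=
  (g 0).choose 2 + ∑ j ∈ Finset.range L, g j * g (j + 1)

lemma sum_range_removeCell {L c : ℕ} {g : ℕ → ℕ} (hc : c < L) (hg : 0 < g c) :
    ∑ j ∈ Finset.range L, removeCell g c j + 1 = ∑ j ∈ Finset.range L, g j := by
  have := sum_Ico_removeCell hc hg 0
  rwa [if_pos (Nat.zero_le c), ← Finset.range_eq_Ico] at this

lemma IsColumns.lt_of_lt {L m c : ℕ} {g : ℕ → ℕ} (h : IsColumns L m g) (hc : g (c + 1) < g c) :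
    c < L := by
  by_contra! hL
  have := h.zero c hL
  omega

lemma antitone_removeCell {c : ℕ} {g : ℕ → ℕ} (h : Antitone g) (hc : g (c + 1) < g c) :
    Antitone (removeCell g c) := by
  refine antitone_nat_of_succ_le fun j => ?_
  have := h (Nat.le_succ j)
  simp only [Nat.succ_eq_add_one] at this
  rcases eq_or_ne j c with rfl | hj
  · rw [removeCell_same, removeCell_of_ne g (by omega)]
    omega
  · rw [removeCell_of_ne g hj]
    rcases eq_or_ne (j + 1) c with rfl | hj'
    · rw [removeCell_same]
      omega
    · rwa [removeCell_of_ne g hj']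

lemma IsColumns.removeCell {L m c : ℕ} {g : ℕ → ℕ} (h : IsColumns L (m + 1) g)
    (hc : g (c + 1) < g c) : IsColumns L m (removeCell g c) where
  anti := antitone_removeCell h.anti hc
  zero j hj := by
    have := h.lt_of_lt hc
    rw [removeCell_of_ne g (by omega), h.zero j hj]
  sum := by
    have := sum_range_removeCell (h.lt_of_lt hc) (Nat.zero_lt_of_lt hc)
    rw [h.sum] at this
    omega

lemma IsColumns.apply_zero_le {L m : ℕ} {g : ℕ → ℕ} (h : IsColumns L m g) : g 0 ≤ m := by
  rcases Nat.eq_zero_or_pos L with rfl | hL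
  · simp [h.zero 0 le_rfl]
  · rw [← h.sum]
    exact Finset.single_le_sum (f := g) (fun _ _ => Nat.zero_le _) (Finset.mem_range.2 hL)

lemma colEnergy_removeCell_zero {L : ℕ} {g : ℕ → ℕ} (hL : 0 < L) (hg : 0 < g 0) :
    colEnergy L g = colEnergy L (removeCell g 0) + removeCell g 0 0 + g 1 := by
  obtain ⟨L, rfl⟩ := Nat.exists_eq_succ_of_ne_zero hL.ne'
  obtain ⟨a, ha⟩ := Nat.exists_eq_succ_of_ne_zero hg.ne'
  simp only [colEnergy, Nat.succ_eq_add_one, Finset.sum_range_succ', removeCell_same]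
  simp only [removeCell_of_ne g (Nat.succ_ne_zero _), ha, Nat.succ_eq_add_one,
    Nat.add_sub_cancel, Nat.choose_succ_succ' a 1, Nat.choose_one_right, zero_add]
  ring

lemma colEnergy_removeCell_succ {L c : ℕ} {g : ℕ → ℕ} (hL : c + 1 < L) (hg : 0 < g (c + 1)) :
    colEnergy L g = colEnergy L (removeCell g (c + 1)) + g c + g (c + 2) := by
  have h : ∀ j, g j * g (j + 1) = removeCell g (c + 1) j * removeCell g (c + 1) (j + 1) +
      (if c + 1 = j then g (c + 2) else 0) + (if c = j then g c else 0) := by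
    intro j
    obtain ⟨a, ha⟩ := Nat.exists_eq_succ_of_ne_zero hg.ne'
    rcases eq_or_ne (c + 1) j with rfl | hj
    · rw [removeCell_same, removeCell_of_ne g (by omega), ha]
      simp
      ring
    · rw [removeCell_of_ne g hj.symm]
      rcases eq_or_ne c j with rfl | hj'
      · rw [removeCell_same, ha]
        simp
        ring
      · rw [removeCell_of_ne g (by omega)]
        simp [hj, hj']
  simp only [colEnergy, removeCell_of_ne g (Nat.succ_ne_zero c).symm]
  simp_rw [Finset.sum_congr rfl fun j _ => h j, Finset.sum_add_distrib, Finset.sum_ite_eq]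
  simp [hL, Nat.lt_of_succ_lt hL]
  ring

lemma sum_card_cellVectors_zero {L m : ℕ} {F : Type*} [Field F] [Fintype F] {h : ℕ → ℕ}
    (hL : 0 < L) :
    (Fintype.card F : ℤ) ^ h 0 *
        ((∑ B ∈ columnMatrices L m F h, (cellVectors B 0).card : ℕ) : ℤ) =
      Fintype.card F ^ m * (columnMatrices L m F h).card := by
  rw [Nat.cast_sum, Finset.mul_sum, mul_comm, ← nsmul_eq_mul]
  refine Finset.sum_eq_card_nsmul fun B hB => ?_
  have := (mem_columnMatrices.1 hB).2.card_liftSpace hL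
  rw [card_cellVectors_zero, mul_comm]
  exact_mod_cast this

lemma sum_card_cellVectors_succ {L m c : ℕ} {F : Type*} [Field F] [Fintype F] {h : ℕ → ℕ}
    (hL : c + 1 < L) (hle : h (c + 1) ≤ h c) :
    (Fintype.card F : ℤ) ^ h c *
        ((∑ B ∈ columnMatrices L m F h, (cellVectors B (c + 1)).card : ℕ) : ℤ) =
      Fintype.card F ^ m * ((Fintype.card F : ℤ) ^ (h c - h (c + 1)) - 1) *
        (columnMatrices L m F h).card := by
  rw [Nat.cast_sum, Finset.mul_sum, mul_comm _ ((columnMatrices L m F h).card : ℤ),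
    ← nsmul_eq_mul]
  refine Finset.sum_eq_card_nsmul fun B hB => ?_
  have h1 := (mem_columnMatrices.1 hB).2.card_liftSpace (Nat.lt_of_succ_lt hL)
  have h2 := (mem_columnMatrices.1 hB).2.card_liftSpace hL
  have h3 := card_cellVectors_succ B c
  obtain ⟨d, hd⟩ := Nat.exists_eq_add_of_le hle
  rw [hd] at h1 ⊢
  rw [Nat.add_sub_cancel_left]
  zify at h1 h2 h3
  rw [← h3] at h2
  rw [pow_add] at h1 ⊢
  linear_combination (Fintype.card F : ℤ) ^ d * h2 - h1

lemma columnMatrices_eq_empty {L m c : ℕ} {F : Type*} [Field F] [Fintype F] {h : ℕ → ℕ}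
    (hc : c + 1 < L) (hlt : h c < h (c + 1)) : columnMatrices L m F h = ∅ := by
  refine Finset.eq_empty_of_forall_notMem fun B hB => ?_
  have := (mem_columnMatrices.1 hB).2.le_of_lt hc
  omega

theorem card_columnMatrices {L : ℕ} {F : Type*} [Field F] [Fintype F] (m : ℕ) (g : ℕ → ℕ)
    (hg : IsColumns L m g) :
    (Fintype.card F : ℤ) ^ colEnergy L g * (columnMatrices L m F g).card =
      Fintype.card F ^ m.choose 2 * ((Fintype.card F : ℤ) - 1) ^ (m - g 0) *
        (colPoly L m g).eval (Fintype.card F : ℤ) := by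
  induction m generalizing g with
  | zero =>
    have h0 : ∀ j, g j = 0 := by
      intro j
      have := hg.apply_zero_le
      have := hg.anti (Nat.zero_le j)
      omega
    have : columnMatrices L 0 F g = {0} := by
      ext A
      rw [Finset.mem_singleton, mem_columnMatrices, iff_true_right (Subsingleton.elim A 0)]
      refine ⟨fun i => i.elim0, fun k => ?_⟩
      rw [Finset.sum_eq_zero fun j _ => h0 j]
      simpa using (A ^ k).rank_le_card_width
    simp [this, colEnergy, h0, colPoly]
  | succ m ih =>
    rw [card_columnMatrices_succ, colPoly, Nat.cast_sum, Finset.mul_sum, eval_finsetSum,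
      Finset.mul_sum]
    refine Finset.sum_congr rfl fun c hcL => ?_
    rw [Finset.mem_range] at hcL
    set q : ℤ := (Fintype.card F : ℤ) with hq
    have hanti := hg.anti (Nat.le_succ c)
    rw [Nat.succ_eq_add_one] at hanti
    rcases Nat.eq_zero_or_pos (g c) with h0 | h0
    · simp [h0]
    rcases hanti.lt_or_eq with hlt | heq
    · have IH := ih _ (hg.removeCell hlt)
      have hle := (hg.removeCell hlt).apply_zero_le
      rw [if_pos hlt, if_pos h0]
      have hch : (m + 1).choose 2 = m + m.choose 2 := by
        rw [Nat.choose_succ_succ' m 1, Nat.choose_one_right]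
      cases c with
      | zero =>
        have hs := sum_card_cellVectors_zero (m := m) (F := F) (h := removeCell g 0) hcL
        have hexp : m + 1 - g 0 = m - removeCell g 0 0 := by
          rw [removeCell_same]; omega
        rw [colEnergy_removeCell_zero hcL h0, hexp, hch]
        simp only [cellWeight, eval_mul, eval_pow, eval_X, pow_add, zero_add, mul_one]
        linear_combination q ^ colEnergy L (removeCell g 0) * q ^ g 1 * hs + q ^ m * q ^ g 1 * IH
      | succ c =>
        have hr := removeCell_of_ne g (Nat.succ_ne_self c).symm
        have hr0 := removeCell_of_ne g (Nat.succ_ne_zero c).symm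
        have hr1 := removeCell_same g (c + 1)
        have hanti' := hg.anti (Nat.le_succ c)
        rw [Nat.succ_eq_add_one] at hanti' hr
        have hs := sum_card_cellVectors_succ (m := m) (F := F) (h := removeCell g (c + 1)) hcL
          (by omega)
        rw [hr0] at hle IH
        have hexp : m + 1 - g 0 = m - g 0 + 1 := by omega
        have hd : removeCell g (c + 1) c - removeCell g (c + 1) (c + 1) =
          g c - g (c + 1) + 1 := by omega
        rw [hd, hr] at hs
        rw [colEnergy_removeCell_succ hcL h0, hexp, hch]
        have hgeom := geom_sum_mul q (g c - g (c + 1) + 1)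
        simp only [cellWeight, eval_mul, eval_pow, eval_X, eval_finsetSum, pow_add, pow_one]
          at hgeom ⊢
        simp only [pow_add, pow_one] at hs
        set W := ∑ i ∈ Finset.range (g c - g (c + 1) + 1), q ^ i
        linear_combination q ^ colEnergy L (removeCell g (c + 1)) * q ^ g (c + 2) * hs +
          q ^ m * q ^ g (c + 2) * (q ^ (g c - g (c + 1)) * q - 1) * IH -
          q ^ g (c + 2) * q ^ m * q ^ m.choose 2 * (q - 1) ^ (m - g 0) *
            eval q (colPoly L m (removeCell g (c + 1))) * hgeom
    · rw [if_neg (by omega : ¬ g (c + 1) < g c), if_pos h0, columnMatrices_eq_empty (c := c)]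
      · simp
      · by_contra! hL
        have := hg.zero (c + 1) hL
        omega
      · rw [removeCell_same, removeCell_of_ne g (by omega)]
        omega

lemma one_le_eval_cellWeight (g : ℕ → ℕ) (c : ℕ) {x : ℤ} (hx : 0 ≤ x) :
    1 ≤ (cellWeight g c).eval x := by
  cases c with
  | zero => simp [cellWeight]
  | succ c =>
    rw [cellWeight, eval_finsetSum, Finset.sum_range_succ']
    simp only [eval_pow, eval_X]
    have : 0 ≤ ∑ i ∈ Finset.range (g c - g (c + 1)), x ^ (i + 1) :=
      Finset.sum_nonneg fun i _ => pow_nonneg hx _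
    simpa using this

lemma eval_colPoly_pos {L : ℕ} (m : ℕ) (g : ℕ → ℕ) (hg : IsColumns L m g) {x : ℤ} (hx : 0 ≤ x) :
    0 < (colPoly L m g).eval x := by
  induction m generalizing g with
  | zero => simp [colPoly]
  | succ m ih =>
    rw [colPoly, eval_finsetSum]
    have hnonneg : ∀ c, g (c + 1) < g c →
        0 < (cellWeight g c).eval x * (colPoly L m (removeCell g c)).eval x := fun c hc =>
      mul_pos (one_le_eval_cellWeight g c hx) (ih _ (hg.removeCell hc))
    have hex : ∃ j, g j = 0 := ⟨L, hg.zero L le_rfl⟩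
    have h0 : g (Nat.find hex) = 0 := Nat.find_spec hex
    have hpos : 0 < Nat.find hex := by
      rw [Nat.find_pos]
      intro h
      have h1 : ∀ j, g j = 0 := fun j => by
        have := hg.anti (Nat.zero_le j)
        omega
      have := hg.sum
      rw [Finset.sum_eq_zero fun j _ => h1 j] at this
      omega
    obtain ⟨c, hc⟩ := Nat.exists_eq_succ_of_ne_zero hpos.ne'
    rw [hc, Nat.succ_eq_add_one] at h0
    have hc' : g (c + 1) < g c := by
      have : ¬ g c = 0 := Nat.find_min hex (by omega)
      omega
    refine Finset.sum_pos' (fun c _ => ?_) ⟨c, Finset.mem_range.2 (hg.lt_of_lt hc'), ?_⟩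
    · split_ifs with h
      · simp only [eval_mul, eval_pow, eval_X, mul_assoc]
        exact mul_nonneg (pow_nonneg hx _) (hnonneg c h).le
      · simp
    · rw [if_pos hc', h0]
      simpa using hnonneg c hc'

/-- Prepend a column which is `k` cells longer than the first column of `h`. -/
def extendCol (k : ℕ) (h : ℕ → ℕ) : ℕ → ℕ
  | 0 => h 0 + k
  | j + 1 => h j

/-- The inverse of the limit of `colPoly` along `extendCol k h`. -/
noncomputable def limitDenom (L s : ℕ) (h : ℕ → ℕ) : ℤ[X] :=
  (1 - X) ^ s * ∏ j ∈ Finset.range L, ∏ i ∈ Finset.Icc 1 (h j - h (j + 1)), (1 - X ^ i)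

lemma removeCell_extendCol_zero (k : ℕ) (h : ℕ → ℕ) :
    removeCell (extendCol (k + 1) h) 0 = extendCol k h := by
  funext j
  cases j with
  | zero => rw [removeCell_same]; rfl
  | succ j => rw [removeCell_of_ne _ (Nat.succ_ne_zero j)]; rfl

lemma removeCell_extendCol_succ (k c : ℕ) {h : ℕ → ℕ} (hc : 0 < h c) :
    removeCell (extendCol k h) (c + 1) =
      extendCol (k + if c = 0 then 1 else 0) (removeCell h c) := by
  funext j
  cases j with
  | zero =>
    rw [removeCell_of_ne _ (Nat.succ_ne_zero c).symm]
    rcases eq_or_ne c 0 with rfl | h0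
    · simp only [extendCol, removeCell_same]
      simp
      omega
    · simp [extendCol, removeCell_of_ne h h0.symm, h0]
  | succ j =>
    rcases eq_or_ne j c with rfl | hj
    · simp [removeCell_same, extendCol]
    · rw [removeCell_of_ne _ (by omega)]
      simp [extendCol, removeCell_of_ne h hj]

lemma IsColumns.extendCol {L s : ℕ} {h : ℕ → ℕ} (hh : IsColumns L s h) (k : ℕ) :
    IsColumns (L + 1) (s + h 0 + k) (extendCol k h) where
  anti := antitone_nat_of_succ_le fun j => by
    cases j with
    | zero => simp [_root_.extendCol]
    | succ j => exact hh.anti (Nat.le_succ j)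
  zero j hj := by
    obtain ⟨j, rfl⟩ := Nat.exists_eq_succ_of_ne_zero (by omega : j ≠ 0)
    exact hh.zero j (by omega)
  sum := by
    rw [Finset.sum_range_succ', ← hh.sum, add_assoc]
    rfl

lemma limitDenom_mul_cellWeight {L t k c : ℕ} {h : ℕ → ℕ} (hanti : Antitone h) (hL : c < L)
    (hc : h (c + 1) < h c) :
    limitDenom L (t + 1) h * cellWeight (extendCol k h) (c + 1) =
      limitDenom L t (removeCell h c) * (1 - X ^ (h c - h (c + 1))) *
        (if c = 0 then 1 - X ^ (k + 1) else 1) := by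
  cases c with
  | zero =>
    have hk : extendCol k h 0 - extendCol k h 1 + 1 = k + 1 := by simp [extendCol]
    have hg := geom_sum_mul_neg (X : ℤ[X]) (k + 1)
    have hprod : ∀ j, (∏ i ∈ Finset.Icc 1 (h j - h (j + 1)), (1 - (X : ℤ[X]) ^ i)) =
        (∏ i ∈ Finset.Icc 1 (removeCell h 0 j - removeCell h 0 (j + 1)), (1 - (X : ℤ[X]) ^ i)) *
          if 0 = j then 1 - X ^ (h 0 - h 1) else 1 := by
      intro j
      rw [removeCell_of_ne h (Nat.succ_ne_zero j)]
      rcases eq_or_ne 0 j with rfl | hj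
      · rw [removeCell_same, if_pos rfl]
        obtain ⟨d, hd⟩ := Nat.exists_eq_add_of_lt hc
        simp only [zero_add] at hd ⊢
        rw [show h 0 - h 1 = d + 1 by omega, show h 0 - 1 - h 1 = d by omega,
          Finset.prod_Icc_succ_top (by omega)]
      · rw [removeCell_of_ne h hj.symm, if_neg hj, mul_one]
    simp only [limitDenom, cellWeight, hk, if_true]
    rw [Finset.prod_congr rfl fun j _ => hprod j, Finset.prod_mul_distrib, Finset.prod_ite_eq,
      if_pos (Finset.mem_range.2 hL), ← hg]
    ring
  | succ c =>
    have hc' := hanti (Nat.le_succ c)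
    rw [Nat.succ_eq_add_one] at hc'
    have hk : extendCol k h (c + 1) - extendCol k h (c + 1 + 1) + 1 = h c - h (c + 1) + 1 := rfl
    have hg := geom_sum_mul_neg (X : ℤ[X]) (h c - h (c + 1) + 1)
    have hprod : ∀ j, (∏ i ∈ Finset.Icc 1 (h j - h (j + 1)), (1 - (X : ℤ[X]) ^ i)) *
        (if c = j then 1 - X ^ (h c - h (c + 1) + 1) else 1) =
        (∏ i ∈ Finset.Icc 1 (removeCell h (c + 1) j - removeCell h (c + 1) (j + 1)),
          (1 - (X : ℤ[X]) ^ i)) *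
          if c + 1 = j then 1 - X ^ (h (c + 1) - h (c + 1 + 1)) else 1 := by
      intro j
      rcases eq_or_ne c j with rfl | hj
      · rw [removeCell_same, removeCell_of_ne h (by omega), if_pos rfl, if_neg (by omega),
          mul_one, show h c - (h (c + 1) - 1) = h c - h (c + 1) + 1 by omega,
          Finset.prod_Icc_succ_top (by omega)]
      · rw [if_neg hj, mul_one, removeCell_of_ne h (by omega : j + 1 ≠ c + 1)]
        rcases eq_or_ne (c + 1) j with rfl | hj'
        · rw [removeCell_same, if_pos rfl]
          obtain ⟨d, hd⟩ := Nat.exists_eq_add_of_lt hc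
          rw [show h (c + 1) - h (c + 1 + 1) = d + 1 by omega,
            show h (c + 1) - 1 - h (c + 1 + 1) = d by omega, Finset.prod_Icc_succ_top (by omega)]
        · rw [removeCell_of_ne h hj'.symm, if_neg hj', mul_one]
    have hP := Finset.prod_congr (rfl : Finset.range L = Finset.range L) fun j _ => hprod j
    rw [Finset.prod_mul_distrib, Finset.prod_mul_distrib, Finset.prod_ite_eq, Finset.prod_ite_eq,
      if_pos (Finset.mem_range.2 hL), if_pos (Finset.mem_range.2 (Nat.lt_of_succ_lt hL)),
      ← hg] at hP
    simp only [limitDenom, cellWeight, hk, Nat.succ_ne_zero, if_false, mul_one]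
    linear_combination (1 - X) ^ t * hP

lemma colPoly_extendCol_succ {L s k : ℕ} {h : ℕ → ℕ} (hh : IsColumns L (s + 1) h) :
    colPoly (L + 1) (s + 1 + h 0 + (k + 1)) (extendCol (k + 1) h) * limitDenom L (s + 1) h - 1 =
      X ^ h 0 * (colPoly (L + 1) (s + 1 + h 0 + k) (extendCol k h) *
        limitDenom L (s + 1) h - 1) +
      ∑ c ∈ Finset.range L, (X ^ h (c + 1) - X ^ h c) * if h (c + 1) < h c then
        (if c = 0 then 1 - X ^ (k + 1 + 1) else 1) *
          (colPoly (L + 1) (s + removeCell h c 0 + (k + 1 + if c = 0 then 1 else 0))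
            (extendCol (k + 1 + if c = 0 then 1 else 0) (removeCell h c)) *
              limitDenom L s (removeCell h c)) - 1 else 0 := by
  have htel := Finset.sum_range_sub (fun j => (X : ℤ[X]) ^ h j) L
  rw [hh.zero L le_rfl, pow_zero] at htel
  rw [← add_assoc, colPoly, Finset.sum_range_succ', if_pos, removeCell_extendCol_zero, add_mul,
    Finset.sum_mul]
  · have hterm : ∀ c ∈ Finset.range L,
        (if extendCol (k + 1) h (c + 1 + 1) < extendCol (k + 1) h (c + 1) then
          X ^ extendCol (k + 1) h (c + 1 + 1) * cellWeight (extendCol (k + 1) h) (c + 1) *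
            colPoly (L + 1) (s + 1 + h 0 + k) (removeCell (extendCol (k + 1) h) (c + 1))
          else 0) * limitDenom L (s + 1) h =
        ((X ^ h (c + 1) - X ^ h c) * if h (c + 1) < h c then
          (if c = 0 then 1 - X ^ (k + 1 + 1) else 1) *
            (colPoly (L + 1) (s + removeCell h c 0 + (k + 1 + if c = 0 then 1 else 0))
              (extendCol (k + 1 + if c = 0 then 1 else 0) (removeCell h c)) *
                limitDenom L s (removeCell h c)) - 1 else 0) + (X ^ h (c + 1) - X ^ h c) := by
      intro c hcL
      have hanti := hh.anti (Nat.le_succ c)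
      rw [Nat.succ_eq_add_one] at hanti
      change (if h (c + 1) < h c then X ^ h (c + 1) * _ * _ else 0) * _ = _
      split_ifs with hc h0
      all_goals try
        have hw := limitDenom_mul_cellWeight (t := s) (k := k + 1) hh.anti
          (Finset.mem_range.1 hcL) hc
        have hpow : (X : ℤ[X]) ^ h c = X ^ h (c + 1) * X ^ (h c - h (c + 1)) := by
          rw [← pow_add, Nat.add_sub_cancel' hanti]
        rw [removeCell_extendCol_succ (k + 1) c (Nat.zero_lt_of_lt hc), hpow]
      · subst h0
        rw [if_pos rfl] at hw
        have hidx : s + removeCell h 0 0 + (k + 1 + 1) = s + 1 + h 0 + k := by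
          rw [removeCell_same]
          omega
        rw [hidx, if_pos rfl]
        linear_combination X ^ h (0 + 1) * colPoly (L + 1) (s + 1 + h 0 + k)
          (extendCol (k + 1 + 1) (removeCell h 0)) * hw
      · rw [if_neg h0, mul_one] at hw
        have hidx : s + removeCell h c 0 + (k + 1 + 0) = s + 1 + h 0 + k := by
          rw [removeCell_of_ne h (Ne.symm h0)]
          omega
        rw [hidx, if_neg h0]
        linear_combination X ^ h (c + 1) * colPoly (L + 1) (s + 1 + h 0 + k)
          (extendCol (k + 1 + 0) (removeCell h c)) * hw
      · rw [show h (c + 1) = h c by omega]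
        ring
    rw [Finset.sum_congr rfl hterm, Finset.sum_add_distrib, htel]
    simp only [cellWeight, extendCol]
    ring
  · simp only [extendCol]
    omega

lemma colPoly_extendCol_of_eq_zero (L k m : ℕ) {h : ℕ → ℕ} (hh : ∀ j, h j = 0) (hm : m = k) :
    colPoly (L + 1) m (extendCol k h) = 1 := by
  subst hm
  induction m with
  | zero => rw [colPoly]
  | succ m ih =>
    rw [colPoly, Finset.sum_range_succ', Finset.sum_eq_zero]
    · rw [removeCell_extendCol_zero, ih]
      simp [extendCol, hh, cellWeight]
    · simp [extendCol, hh]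

theorem eventually_X_pow_dvd_colPoly {L : ℕ} (s : ℕ) (h : ℕ → ℕ) (hh : IsColumns L s h) (p : ℕ) :
    ∀ᶠ k in Filter.atTop, (X : ℤ[X]) ^ p ∣
      colPoly (L + 1) (s + h 0 + k) (extendCol k h) * limitDenom L s h - 1 := by
  induction s generalizing h p with
  | zero =>
    have h0 : ∀ j, h j = 0 := by
      intro j
      have := hh.apply_zero_le
      have := hh.anti (Nat.zero_le j)
      omega
    refine Filter.Eventually.of_forall fun k => ?_
    rw [colPoly_extendCol_of_eq_zero L k _ h0 (by simp [h0])]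
    simp [limitDenom, h0]
  | succ s ih =>
    have hpos : 0 < h 0 := by
      by_contra! h0
      have h1 : ∀ j, h j = 0 := fun j => by
        have := hh.anti (Nat.zero_le j)
        omega
      have := hh.sum
      rw [Finset.sum_eq_zero fun j _ => h1 j] at this
      omega
    have hrest : ∀ p : ℕ, ∀ᶠ k in Filter.atTop, ∀ c ∈ Finset.range L, (X : ℤ[X]) ^ p ∣
        if h (c + 1) < h c then
          (if c = 0 then 1 - X ^ (k + 1 + 1) else 1) *
          (colPoly (L + 1) (s + removeCell h c 0 + (k + 1 + if c = 0 then 1 else 0))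
            (extendCol (k + 1 + if c = 0 then 1 else 0) (removeCell h c)) *
              limitDenom L s (removeCell h c)) - 1 else 0 := by
      intro p
      rw [Filter.eventually_all_finset]
      intro c _
      split_ifs with hc
      · have hv := ih _ (hh.removeCell hc) p
        rw [← Filter.map_add_atTop_eq_nat 2, Filter.eventually_map] at hv
        filter_upwards [hv, Filter.eventually_ge_atTop p] with k hk hkp
        rw [sub_mul, one_mul, sub_right_comm]
        exact dvd_sub hk (Dvd.dvd.mul_right (pow_dvd_pow X (by omega)) _)
      · have hv := ih _ (hh.removeCell hc) p
        rw [← Filter.map_add_atTop_eq_nat 1, Filter.eventually_map] at hv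
        filter_upwards [hv] with k hk
        rwa [one_mul]
      · simp
    induction p with
    | zero => simp
    | succ p ihp =>
      rw [← Filter.map_add_atTop_eq_nat 1, Filter.eventually_map]
      filter_upwards [ihp, hrest (p + 1)] with k hk hr
      rw [colPoly_extendCol_succ hh]
      refine dvd_add ?_ (Finset.dvd_sum fun c hc => (hr c hc).mul_left _)
      rw [pow_succ']
      exact mul_dvd_mul (dvd_pow_self X hpos.ne') hk

lemma eq_of_X_sub_C_pow_mul_eq {r : ℤ} {a b : ℕ} {U V : ℤ[X]} (hU : U.eval r ≠ 0)
    (hV : V.eval r ≠ 0) (h : (X - C r) ^ a * U = (X - C r) ^ b * V) : U = V := by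
  wlog hab : a ≤ b generalizing a b U V
  · exact (this hV hU h.symm (by omega)).symm
  obtain ⟨t, rfl⟩ := Nat.exists_eq_add_of_le hab
  rw [pow_add, mul_assoc] at h
  have h' := mul_left_cancel₀ (pow_ne_zero a (X_sub_C_ne_zero r)) h
  cases t with
  | zero => simpa using h'
  | succ t => exact absurd (by simp [h']) hU

lemma eq_of_X_pow_mul_X_sub_one_pow_mul_eq {a b c d : ℕ} {U V : ℤ[X]} (hU0 : U.eval 0 ≠ 0)
    (hV0 : V.eval 0 ≠ 0) (hU1 : U.eval 1 ≠ 0) (hV1 : V.eval 1 ≠ 0)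
    (h : X ^ a * ((X - 1) ^ b * U) = X ^ c * ((X - 1) ^ d * V)) : U = V := by
  refine eq_of_X_sub_C_pow_mul_eq (r := 1) (a := b) (b := d) hU1 hV1 ?_
  refine eq_of_X_sub_C_pow_mul_eq (r := 0) (a := a) (b := c) ?_ ?_ (by simpa using h)
  · simpa using hU0
  · simpa using hV0

lemma sum_Ico_ite_lt {x L : ℕ} (hx : x ≤ L) (t : ℕ) :
    ∑ j ∈ Finset.Ico t L, (if j < x then 1 else 0) = x - t := by
  rw [← Finset.card_filter, ← Nat.card_Ico]
  congr 1
  ext j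
  simp only [Finset.mem_filter, Finset.mem_Ico]
  omega

lemma dualPart_eq_add (f : ℕ → ℕ) (N j : ℕ) :
    dualPart f N j = alphaCount f N j + dualPart f N (j + 1) := by
  simp only [dualPart, alphaCount, Finset.card_filter, ← Finset.sum_add_distrib]
  refine Finset.sum_congr rfl fun i _ => ?_
  split_ifs <;> omega

lemma dualPart_eq_zero {f : ℕ → ℕ} (hf : ∀ i j, i ≤ j → f j ≤ f i) {N j : ℕ} (hj : f 1 < j) :
    dualPart f N j = 0 := by
  rw [dualPart, Finset.card_eq_zero, Finset.filter_eq_empty_iff]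
  intro i hi
  have := hf 1 i (Finset.mem_Icc.1 hi).1
  omega

lemma dualPart_two {f : ℕ → ℕ} {N : ℕ} (h2 : ∀ i, 1 ≤ i → i ≤ N → 2 ≤ f i) :
    dualPart f N 2 = N := by
  rw [dualPart, Finset.filter_true_of_mem, Nat.card_Icc, Nat.add_sub_cancel]
  intro i hi
  exact h2 i (Finset.mem_Icc.1 hi).1 (Finset.mem_Icc.1 hi).2

lemma extendCol_dualPart {f : ℕ → ℕ} {N : ℕ} (h2 : ∀ i, 1 ≤ i → i ≤ N → 2 ≤ f i) (k j : ℕ) :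
    extendCol k (fun j => dualPart f N (j + 2)) j =
      ∑ i ∈ Finset.Icc 1 (N + k), if j < extendOnes f N k i then 1 else 0 := by
  rw [← Finset.card_filter]
  cases j with
  | zero =>
    rw [Finset.filter_true_of_mem, Nat.card_Icc, Nat.add_sub_cancel]
    · simp [extendCol, dualPart_two h2]
    · intro i hi
      rw [Finset.mem_Icc] at hi
      unfold extendOnes
      split_ifs with h
      · have := h2 i hi.1 h
        omega
      · omega
      · exact absurd hi.2 ‹_›
  | succ j =>
    simp only [extendCol, dualPart]
    congr 1
    ext i
    simp only [Finset.mem_filter, Finset.mem_Icc]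
    unfold extendOnes
    split_ifs <;> omega

lemma sum_extendOnes_sub {f : ℕ → ℕ} (hf : ∀ i j, i ≤ j → f j ≤ f i) {N : ℕ}
    (h2 : ∀ i, 1 ≤ i → i ≤ N → 2 ≤ f i) (k t : ℕ) :
    ∑ i ∈ Finset.Icc 1 (N + k), (extendOnes f N k i - t) =
      ∑ j ∈ Finset.Ico t (f 1 + 1), extendCol k (fun j => dualPart f N (j + 2)) j := by
  simp_rw [extendCol_dualPart h2]
  rw [Finset.sum_comm]
  refine Finset.sum_congr rfl fun i hi => (sum_Ico_ite_lt ?_ t).symm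
  have := hf 1 i (Finset.mem_Icc.1 hi).1
  unfold extendOnes
  split_ifs <;> omega

lemma isColumns_dualPart {f : ℕ → ℕ} {n N : ℕ} (hf : IsPartitionFun f n N)
    (h2 : ∀ i, 1 ≤ i → i ≤ N → 2 ≤ f i) :
    N ≤ n ∧ IsColumns (f 1) (n - N) (fun j => dualPart f N (j + 2)) := by
  have hsum : ∑ i ∈ Finset.Icc 1 N, (f i - 1) + N = n := by
    have hN : ∑ _i ∈ Finset.Icc 1 N, 1 = N := by simp
    rw [← hf.2.2]
    nth_rw 2 [← hN]
    rw [← Finset.sum_add_distrib]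
    refine Finset.sum_congr rfl fun i hi => ?_
    have := h2 i (Finset.mem_Icc.1 hi).1 (Finset.mem_Icc.1 hi).2
    omega
  refine ⟨by omega, antitone_nat_of_succ_le fun j => ?_, fun j hj => ?_, ?_⟩
  · have := dualPart_eq_add f N (j + 2)
    simp only [Nat.add_right_comm j 1 2]
    omega
  · exact dualPart_eq_zero hf.1 (by omega)
  · have h := sum_extendOnes_sub hf.1 h2 0 1
    rw [Finset.sum_Ico_eq_sum_range, Nat.add_sub_cancel] at h
    simp only [Nat.add_comm 1, extendCol] at h
    rw [← h, ← hsum, Nat.add_sub_cancel]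
    refine Finset.sum_congr rfl fun i hi => ?_
    rw [extendOnes, if_pos (Finset.mem_Icc.1 hi).2]

lemma jordanCount_extendOnes {f : ℕ → ℕ} (hf : ∀ i j, i ≤ j → f j ≤ f i) {N : ℕ}
    (h2 : ∀ i, 1 ≤ i → i ≤ N → 2 ≤ f i) (m k : ℕ) (F : Type) [Field F] [Fintype F] :
    jordanCount m (extendOnes f N k) (N + k) F =
      (columnMatrices (f 1 + 1) m F (extendCol k fun j => dualPart f N (j + 2))).card := by
  rw [jordanCount]
  refine Nat.subtype_card _ fun A => ?_
  simp only [mem_columnMatrices, HasJordanType, HasColumns, sum_extendOnes_sub hf h2]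

lemma prod_alphaCount {f : ℕ → ℕ} (hf : ∀ i j, i ≤ j → f j ≤ f i) (N s : ℕ) :
    limitDenom (f 1) s (fun j => dualPart f N (j + 2)) =
      (1 - X) ^ s * ∏ i ∈ Finset.Icc 2 (f 1), ∏ j ∈ Finset.Icc 1 (alphaCount f N i),
        (1 - (X : ℤ[X]) ^ j) := by
  have halpha : ∀ j, dualPart f N (j + 2) - dualPart f N (j + 1 + 2) =
      alphaCount f N (j + 2) := by
    intro j
    have := dualPart_eq_add f N (j + 2)
    rw [Nat.add_right_comm j 1 2]
    omega
  simp only [limitDenom, halpha]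
  rw [← Finset.Ico_succ_right_eq_Icc, Finset.prod_Ico_eq_prod_range]
  congr 1
  simp only [Nat.add_comm 2]
  refine (Finset.prod_subset (Finset.range_subset_range.2 ?_) fun j _ hj => ?_).symm
  · rw [Order.succ_eq_add_one]
    omega
  · rw [Finset.mem_range, Order.succ_eq_add_one] at hj
    have h0 : alphaCount f N (j + 2) = 0 := by
      have h1 := dualPart_eq_add f N (j + 2)
      rw [dualPart_eq_zero hf (by omega : f 1 < j + 2)] at h1
      omega
    simp [h0]

theorem colPoly_eq_of_jordanCount {n N : ℕ} {f : ℕ → ℕ} (hf : IsPartitionFun f n N)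
    (h2 : ∀ i, 1 ≤ i → i ≤ N → 2 ≤ f i) {k d e : ℕ} {P R : ℤ[X]}
    (hP : ∀ (F : Type) [Field F] [Fintype F],
      (jordanCount (n + k) (extendOnes f N k) (N + k) F : ℤ) = P.eval (Fintype.card F : ℤ))
    (hfac : P = X ^ d * (X - 1) ^ e * R) (hR0 : R.eval 0 ≠ 0) (hR1 : R.eval 1 ≠ 0) :
    R = colPoly (f 1 + 1) (n + k) (extendCol k fun j => dualPart f N (j + 2)) := by
  set g := extendCol k fun j => dualPart f N (j + 2) with hg
  obtain ⟨hle, hcol⟩ := isColumns_dualPart hf h2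
  have hcols : IsColumns (f 1 + 1) (n + k) g := by
    have h := hcol.extendCol k
    have hn : n - N + dualPart f N 2 + k = n + k := by
      rw [dualPart_two h2]
      omega
    exact hn ▸ h
  have key : X ^ colEnergy (f 1 + 1) g * P =
      X ^ (n + k).choose 2 * (X - 1) ^ (n + k - g 0) * colPoly (f 1 + 1) (n + k) g := by
    refine eq_of_infinite_eval_eq _ _ ?_
    refine (Nat.infinite_setOfPred_prime.image (Nat.cast_injective (R := ℤ)).injOn).mono ?_
    rintro _ ⟨p, hp, rfl⟩
    have : Fact p.Prime := ⟨hp⟩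
    have h1 := card_columnMatrices (F := ZMod p) (n + k) g hcols
    rw [← jordanCount_extendOnes hf.1 h2, hP (ZMod p), ZMod.card] at h1
    simpa using h1
  refine eq_of_X_pow_mul_X_sub_one_pow_mul_eq (a := colEnergy (f 1 + 1) g + d) (b := e) hR0
    (eval_colPoly_pos _ _ hcols le_rfl).ne' hR1 (eval_colPoly_pos _ _ hcols zero_le_one).ne'
    (c := (n + k).choose 2) (d := n + k - g 0) ?_
  rw [← mul_assoc (X ^ (n + k).choose 2), ← key, hfac]
  ring

theorem R_limit (n N : ℕ) (f : ℕ → ℕ) (hf : IsPartitionFun f n N)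
    (h2 : ∀ i, 1 ≤ i → i ≤ N → 2 ≤ f i)
    (P R : ℕ → Polynomial ℤ) (d e : ℕ → ℕ)
    (hP : ∀ k : ℕ, ∀ (F : Type) [Field F] [Fintype F],
      (jordanCount (n + k) (extendOnes f N k) (N + k) F : ℤ) =
        (P k).eval (Fintype.card F : ℤ))
    (hfac : ∀ k : ℕ, P k = X ^ (d k) * (X - 1) ^ (e k) * R k)
    (hR0 : ∀ k : ℕ, (R k).eval 0 ≠ 0) (hR1 : ∀ k : ℕ, (R k).eval 1 ≠ 0) :
    ∀ m : ℕ, ∃ K : ℕ, ∀ k : ℕ, K ≤ k →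
      (R k * ((1 - X : Polynomial ℤ) ^ (n - N) *
        ∏ i ∈ Finset.Icc 2 (f 1),
          ∏ j ∈ Finset.Icc 1 (alphaCount f N i), (1 - (X : Polynomial ℤ) ^ j))).coeff m =
      if m = 0 then 1 else 0 := by
  intro m
  obtain ⟨hle, hcol⟩ := isColumns_dualPart hf h2
  obtain ⟨K, hK⟩ := Filter.eventually_atTop.1
    (eventually_X_pow_dvd_colPoly (n - N) _ hcol (m + 1))
  refine ⟨K, fun k hk => ?_⟩
  have hdvd := hK k hk
  rw [dualPart_two h2, Nat.sub_add_cancel hle, prod_alphaCount hf.1,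
    ← colPoly_eq_of_jordanCount hf h2 (hP k) (hfac k) (hR0 k) (hR1 k)] at hdvd
  have hcoeff := X_pow_dvd_iff.1 hdvd m (Nat.lt_succ_self m)
  rw [coeff_sub, sub_eq_zero] at hcoeff
  rw [hcoeff, coeff_one]
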